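/- Let N ≥ 1 and let w : {0,…,N} → ℤ_{>0} be a weight function. Grade ℂ[x_0,…,x_N] by weighted degree with respect to w. Let f_1,…,f_k (with 1 ≤ k ≤ N−1) be a regular sequence in ℂ[x_0,…,x_N] consisting of weighted homogeneous polynomials of positive weighted degrees, and suppose the complete intersection they define is quasi-smooth: for every nonzero point v ∈ ℂ^{N+1} with f_1(v) = ⋯ = f_k(v) = 0, the k × (N+1) Jacobian matrix (∂f_j/∂x_i)(v) has rank k. Then the zero locus of {f_1,…,f_k} in the projective spectrum Proj of this graded ring is an irreducible subspace. -/

import Mathlib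

open MvPolynomial

section RegularSequences

variable {R : Type*} [CommRing R]

/-- `y` is a nonzerodivisor modulo the ideal `J`. -/
def IsRegularMod (J : Ideal R) (y : R) : Prop :=
  ∀ g, g * y ∈ J → g ∈ J

/-- There is a sequence of length `t` of elements of `n` which is (weakly) regular on `R ⧸ J`. -/
def HasRegularSeq (n : Ideal R) : ℕ → Ideal R → Prop
  | 0, _ => True
  | t + 1, J => ∃ y ∈ n, IsRegularMod J y ∧ HasRegularSeq n t (J ⊔ Ideal.span {y})

lemma HasRegularSeq.mono {n : Ideal R} {s t : ℕ} (hst : s ≤ t) {J : Ideal R}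
    (h : HasRegularSeq n t J) : HasRegularSeq n s J := by
  induction s generalizing t J with
  | zero => trivial
  | succ s ih =>
    obtain ⟨t, rfl⟩ : ∃ t', t = t' + 1 := ⟨t - 1, by omega⟩
    obtain ⟨y, hy, hreg, h⟩ := h
    exact ⟨y, hy, hreg, ih (by omega) h⟩

lemma mem_sup_span_singleton_iff {J : Ideal R} {y u : R} :
    u ∈ J ⊔ Ideal.span {y} ↔ ∃ r, u - r * y ∈ J := by
  rw [sup_comm, Ideal.mem_span_singleton_sup]
  constructor
  · rintro ⟨r, b, hb, rfl⟩
    exact ⟨r, by simpa using hb⟩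
  · rintro ⟨r, hr⟩
    exact ⟨r, _, hr, by ring⟩

lemma IsRegularMod.swap_left {J : Ideal R} {y z : R} (hy : IsRegularMod J y)
    (hz : IsRegularMod (J ⊔ Ideal.span {y}) z) : IsRegularMod (J ⊔ Ideal.span {z}) y := by
  intro u hu
  obtain ⟨v, hv⟩ := mem_sup_span_singleton_iff.1 hu
  have hvJ : v ∈ J ⊔ Ideal.span {y} := by
    refine hz v (mem_sup_span_singleton_iff.2 ⟨u, ?_⟩)
    rw [← neg_mem_iff]
    convert hv using 1
    ring
  obtain ⟨r, hr⟩ := mem_sup_span_singleton_iff.1 hvJ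
  refine mem_sup_span_singleton_iff.2 ⟨r, hy _ ?_⟩
  have := J.add_mem hv (J.mul_mem_left z hr)
  convert this using 1
  ring

/-- Let `x`, `y` be regular modulo `J`, with `y` in `n`. If no nonzero element of
`R ⧸ (J, y)` is annihilated by `n`, then no nonzero element of `R ⧸ (J, x)` is. -/
lemma mem_sup_span_of_forall_mul_mem {n J : Ideal R} {x y : R} (hyn : y ∈ n)
    (hx : IsRegularMod J x) (hy : IsRegularMod J y)
    (h : ∀ u, (∀ m ∈ n, m * u ∈ J ⊔ Ideal.span {y}) → u ∈ J ⊔ Ideal.span {y})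
    {u : R} (hu : ∀ m ∈ n, m * u ∈ J ⊔ Ideal.span {x}) : u ∈ J ⊔ Ideal.span {x} := by
  obtain ⟨u', hu'⟩ := mem_sup_span_singleton_iff.1 (hu y hyn)
  have h1 : u' ∈ J ⊔ Ideal.span {y} := by
    refine h u' fun m hm => ?_
    obtain ⟨r, hr⟩ := mem_sup_span_singleton_iff.1 (hu m hm)
    refine mem_sup_span_singleton_iff.2 ⟨r, hx _ ?_⟩
    have := J.sub_mem (J.mul_mem_left y hr) (J.mul_mem_left m hu')
    convert this using 1
    ring
  obtain ⟨r, hr⟩ := mem_sup_span_singleton_iff.1 h1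
  refine mem_sup_span_singleton_iff.2 ⟨r, hy _ ?_⟩
  have := J.add_mem hu' (J.mul_mem_left x hr)
  convert this using 1
  ring

/-- The zero divisors modulo `J` are the union of the finitely many associated primes of `J`. -/
lemma exists_finite_primes_isRegularMod [IsNoetherianRing R] (J : Ideal R) :
    ∃ s : Set (Ideal R), s.Finite ∧
      (∀ P ∈ s, P.IsPrime ∧ ∃ u ∉ J, ∀ r, r ∈ P ↔ r * u ∈ J) ∧
      ∀ z, (∀ P ∈ s, z ∉ P) → IsRegularMod J z := by
  refine ⟨associatedPrimes R (R ⧸ J), associatedPrimes.finite R _, fun P hP => ?_, ?_⟩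
  · rw [AssociatedPrimes.mem_iff, isAssociatedPrime_iff] at hP
    obtain ⟨hP, x, rfl⟩ := hP
    obtain ⟨u, rfl⟩ := Ideal.Quotient.mk_surjective x
    have key : ∀ r, r ∈ Submodule.colon (⊥ : Submodule R (R ⧸ J)) {Ideal.Quotient.mk J u} ↔
        r * u ∈ J := by
      intro r
      rw [Submodule.mem_colon_singleton, Submodule.mem_bot, Algebra.smul_def,
        Ideal.Quotient.algebraMap_eq, ← map_mul, Ideal.Quotient.eq_zero_iff_mem]
    refine ⟨hP, u, fun hu => hP.ne_top ?_, key⟩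
    rw [Ideal.eq_top_iff_one, key, one_mul]
    exact hu
  · intro z hz g hg
    by_contra hgJ
    have : z ∈ ⋃ p ∈ associatedPrimes R (R ⧸ J), (p : Set R) := by
      rw [biUnion_associatedPrimes_eq_zero_divisors]
      refine ⟨Ideal.Quotient.mk J g, ?_, ?_⟩
      · rwa [Ne, Ideal.Quotient.eq_zero_iff_mem]
      · rw [Algebra.smul_def, Ideal.Quotient.algebraMap_eq, ← map_mul,
          Ideal.Quotient.eq_zero_iff_mem, mul_comm]
        exact hg
    simp only [Set.mem_iUnion] at this
    obtain ⟨P, hP, hzP⟩ := this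
    exact hz P hP hzP

lemma exists_isRegularMod_of_forall [IsNoetherianRing R] {n J J' : Ideal R}
    (h : ∀ u, (∀ m ∈ n, m * u ∈ J) → u ∈ J) (h' : ∀ u, (∀ m ∈ n, m * u ∈ J') → u ∈ J') :
    ∃ z ∈ n, IsRegularMod J z ∧ IsRegularMod J' z := by
  obtain ⟨s, hs, hsP, hsr⟩ := exists_finite_primes_isRegularMod J
  obtain ⟨s', hs', hsP', hsr'⟩ := exists_finite_primes_isRegularMod J'
  by_contra! hcon
  have hsub : (n : Set R) ⊆ ⋃ P ∈ s ∪ s', ((id P : Ideal R) : Set R) := by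
    intro z hz
    by_contra hz'
    simp only [Set.mem_iUnion, not_exists] at hz'
    exact hcon z hz (hsr z fun P hP => hz' P (Or.inl hP)) (hsr' z fun P hP => hz' P (Or.inr hP))
  obtain ⟨P, hP, hnP⟩ := (Ideal.subset_union_prime_finite (hs.union hs') ⊥ ⊥
    (fun P hP _ _ => hP.elim (fun hP => (hsP P hP).1) (fun hP => (hsP' P hP).1))).1 hsub
  rcases hP with hP | hP
  · obtain ⟨-, u, hu, hPu⟩ := hsP P hP
    exact hu (h u fun m hm => (hPu m).1 (hnP hm))
  · obtain ⟨-, u, hu, hPu⟩ := hsP' P hP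
    exact hu (h' u fun m hm => (hPu m).1 (hnP hm))

/-- Dividing by a regular element lowers the length of regular sequences only by one. -/
lemma HasRegularSeq.sup_span [IsNoetherianRing R] {n : Ideal R} {t : ℕ} {J : Ideal R}
    (h : HasRegularSeq n (t + 1) J) {x : R} (hxn : x ∈ n) (hx : IsRegularMod J x) :
    HasRegularSeq n t (J ⊔ Ideal.span {x}) := by
  induction t generalizing J x with
  | zero => trivial
  | succ t ih =>
    obtain ⟨y, hyn, hy, hyt⟩ := h
    have hysoc : ∀ u, (∀ m ∈ n, m * u ∈ J ⊔ Ideal.span {y}) → u ∈ J ⊔ Ideal.span {y} := by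
      obtain ⟨z, hzn, hz, -⟩ := hyt
      exact fun u hu => hz u (by rw [mul_comm]; exact hu z hzn)
    obtain ⟨z, hzn, hzy, hzx⟩ := exists_isRegularMod_of_forall hysoc
      (fun u => mem_sup_span_of_forall_mul_mem hyn hx hy hysoc)
    have hz : HasRegularSeq n (t + 1) (J ⊔ Ideal.span {z}) := by
      refine ⟨y, hyn, hy.swap_left hzy, ?_⟩
      rw [sup_right_comm]
      exact ih hyt hzn hzy
    refine ⟨z, hzn, hzx, ?_⟩
    rw [sup_right_comm]
    exact ih hz hxn (hx.swap_left hzx)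

lemma IsRegularMod.pow {J : Ideal R} {b : R} (hb : IsRegularMod J b) (q : ℕ) :
    IsRegularMod J (b ^ q) := by
  induction q with
  | zero => intro g hg; simpa using hg
  | succ q ih => exact fun g hg => ih g (hb _ (by rwa [mul_assoc, ← pow_succ]))

lemma IsRegularMod.sup_span_pow {J : Ideal R} {a b : R} (ha : IsRegularMod J a)
    (hb : IsRegularMod (J ⊔ Ideal.span {a}) b) (p : ℕ) :
    IsRegularMod (J ⊔ Ideal.span {a ^ p}) b := by
  induction p with
  | zero => intro g _; simp
  | succ p ih =>
    intro g hg
    obtain ⟨h, hh⟩ := mem_sup_span_singleton_iff.1 hg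
    obtain ⟨g', hg'⟩ := mem_sup_span_singleton_iff.1
      (hb g (mem_sup_span_singleton_iff.2 ⟨h * a ^ p, by convert hh using 1; ring⟩))
    have h1 : g' * b - h * a ^ p ∈ J := by
      refine ha _ ?_
      have := J.sub_mem hh (J.mul_mem_left b hg')
      convert this using 1
      ring
    obtain ⟨r, hr⟩ := mem_sup_span_singleton_iff.1 (ih g' (mem_sup_span_singleton_iff.2 ⟨h, h1⟩))
    refine mem_sup_span_singleton_iff.2 ⟨r, ?_⟩
    have := J.add_mem hg' (J.mul_mem_left a hr)
    convert this using 1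
    ring

lemma IsRegularMod.notMem_of_mem_minimalPrimes {J P : Ideal R} {y : R} (hy : IsRegularMod J y)
    (hP : P ∈ J.minimalPrimes) : y ∉ P := by
  intro hyP
  obtain ⟨z, hz, hyz⟩ := Ideal.exists_mul_mem_of_mem_minimalPrimes hP hyP
  exact hz (hy z (by rwa [mul_comm]))

/-- Regular sequences remain regular in localizations. -/
lemma HasRegularSeq.map_localization {n J : Ideal R} {t : ℕ} (h : HasRegularSeq n t J)
    (M : Submonoid R) (S : Type*) [CommRing S] [Algebra R S] [IsLocalization M S] :
    HasRegularSeq (n.map (algebraMap R S)) t (J.map (algebraMap R S)) := by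
  induction t generalizing J with
  | zero => trivial
  | succ t ih =>
    obtain ⟨y, hyn, hy, h⟩ := h
    refine ⟨algebraMap R S y, Ideal.mem_map_of_mem _ hyn, fun g hg => ?_, ?_⟩
    · obtain ⟨⟨r, s⟩, hrs⟩ := IsLocalization.surj M g
      have h1 : algebraMap R S (r * y) ∈ J.map (algebraMap R S) := by
        rw [map_mul, ← hrs, mul_right_comm]
        exact Ideal.mul_mem_right _ _ hg
      rw [IsLocalization.algebraMap_mem_map_algebraMap_iff M] at h1
      obtain ⟨m, hm, hmJ⟩ := h1
      have h2 : m * r ∈ J := hy _ (by rwa [mul_assoc])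
      have h3 : g * algebraMap R S s ∈ J.map (algebraMap R S) := by
        rw [hrs, IsLocalization.algebraMap_mem_map_algebraMap_iff M]
        exact ⟨m, hm, h2⟩
      exact (Ideal.mul_unit_mem_iff_mem _ (IsLocalization.map_units S s)).1 h3
    · have := ih h
      rwa [Ideal.map_sup, Ideal.map_span, Set.image_singleton] at this

end RegularSequences

section LocalRing

open IsLocalRing

variable {R : Type*} [CommRing R] [IsNoetherianRing R] [IsLocalRing R]

lemma isPrime_of_isPrime_sup_span {J : Ideal R} {y : R} (hyn : y ∈ maximalIdeal R)
    (hy : IsRegularMod J y) (hQ : (J ⊔ Ideal.span {y}).IsPrime) : J.IsPrime := by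
  obtain ⟨P, hP, hPQ⟩ := Ideal.exists_minimalPrimes_le (le_sup_left : J ≤ J ⊔ Ideal.span {y})
  have hPp : P.IsPrime := hP.1.1
  have hyP : y ∉ P := hy.notMem_of_mem_minimalPrimes hP
  have hle : P ≤ J := by
    refine Submodule.le_of_le_smul_of_le_jacobson_bot (I := maximalIdeal R)
      (IsNoetherian.noetherian P) (maximalIdeal_le_jacobson _) fun p hp => ?_
    obtain ⟨r, hr⟩ := mem_sup_span_singleton_iff.1 (hPQ hp)
    have hryP : r * y ∈ P := by
      have := P.sub_mem hp (hP.1.2 hr)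
      rwa [sub_sub_cancel] at this
    have hrP : r ∈ P := (hPp.mem_or_mem hryP).resolve_right hyP
    have hry : y * r ∈ maximalIdeal R • P := Submodule.smul_mem_smul hyn hrP
    have := Submodule.add_mem_sup hr hry
    convert this using 1
    ring
  rwa [le_antisymm hP.1.2 hle]

/-- In a Noetherian local ring, an ideal `J` such that `R ⧸ J` has depth at least `t` and
maximal ideal generated by `t` elements is prime (i.e. regular local rings are domains). -/
lemma HasRegularSeq.isPrime {t : ℕ} {J : Ideal R} (hJ : J ≤ maximalIdeal R)
    (h : HasRegularSeq (maximalIdeal R) t J) (z : Fin t → R)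
    (hzn : ∀ i, z i ∈ maximalIdeal R)
    (hz : maximalIdeal R ≤ J ⊔ Ideal.span (Set.range z)) : J.IsPrime := by
  induction t generalizing J with
  | zero =>
    have : J = maximalIdeal R := le_antisymm hJ (by simpa using hz)
    rw [this]
    infer_instance
  | succ t ih =>
    have h0 := h
    obtain ⟨x, hxn, hx, -⟩ := h
    have h1J : (1 : R) ∉ J := fun h1 => (maximalIdeal R).ne_top_iff_one.1 (by
      exact Ideal.IsPrime.ne_top inferInstance) (hJ h1)
    obtain ⟨s, hs, hsP, hsr⟩ := exists_finite_primes_isRegularMod J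
    obtain ⟨y, hyn, hyreg, hyN⟩ : ∃ y ∈ maximalIdeal R, IsRegularMod J y ∧
        y ∉ J ⊔ maximalIdeal R * maximalIdeal R := by
      by_contra! hcon
      set N := J ⊔ maximalIdeal R * maximalIdeal R with hN
      have hsub : (maximalIdeal R : Set R) ⊆
          ⋃ P ∈ insert N s, ((id P : Ideal R) : Set R) := by
        intro y hy
        by_contra hy'
        simp only [Set.mem_iUnion, not_exists] at hy'
        exact hy' N (Set.mem_insert _ _) (hcon y hy (hsr y fun P hP => hy' P (Or.inr hP)))
      obtain ⟨P, hP, hnP⟩ := (Ideal.subset_union_prime_finite (hs.insert N) N N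
        (fun P hP hPN _ => (hsP P (hP.resolve_left hPN)).1)).1 hsub
      rcases hP with rfl | hP
      · have hnJ : maximalIdeal R ≤ J :=
          Submodule.le_of_le_smul_of_le_jacobson_bot (IsNoetherian.noetherian _)
            (maximalIdeal_le_jacobson _) hnP
        exact h1J (hx 1 (by rw [one_mul]; exact hnJ hxn))
      · obtain ⟨-, u, hu, hPu⟩ := hsP P hP
        exact hu (hx u (by rw [mul_comm]; exact (hPu x).1 (hnP hxn)))
    refine isPrime_of_isPrime_sup_span hyn hyreg ?_
    have hJy : J ⊔ Ideal.span {y} ≤ maximalIdeal R :=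
      sup_le hJ ((Ideal.span_singleton_le_iff_mem _).2 hyn)
    obtain ⟨j, hj, c, hc, hjc⟩ := Submodule.mem_sup.1 (hz hyn)
    obtain ⟨r, rfl⟩ := (Ideal.mem_span_range_iff_exists_fun).1 hc
    have hzi : ∀ i, IsUnit (r i) → z i ∈ J ⊔ Ideal.span {y} ⊔
        Ideal.span (Set.range fun l => z (i.succAbove l)) := by
      intro i hi
      rw [← Ideal.unit_mul_mem_iff_mem _ hi]
      rw [Fin.sum_univ_succAbove _ i] at hjc
      have : r i * z i = (-j + 1 * y) +
          -∑ l, r (i.succAbove l) * z (i.succAbove l) := by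
        rw [← hjc]; ring
      rw [this]
      refine Submodule.add_mem_sup (Submodule.add_mem_sup (neg_mem hj)
        (Ideal.mul_mem_left _ _ (Ideal.mem_span_singleton_self y))) (neg_mem ?_)
      exact Ideal.sum_mem _ fun l _ => Ideal.mul_mem_left _ _ (Ideal.subset_span ⟨l, rfl⟩)
    obtain ⟨i, hi⟩ : ∃ i, IsUnit (r i) := by
      by_contra! hcon
      refine hyN (hjc ▸ Submodule.add_mem_sup hj (Ideal.sum_mem _ fun i _ => ?_))
      exact Ideal.mul_mem_mul ((mem_maximalIdeal _).2 (hcon i)) (hzn i)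
    refine ih hJy (h0.sup_span hyn hyreg) (fun l => z (i.succAbove l)) (fun l => hzn _) ?_
    refine hz.trans (sup_le (le_sup_left.trans le_sup_left) (Ideal.span_le.2 ?_))
    rintro _ ⟨l, rfl⟩
    rcases Fin.eq_self_or_eq_succAbove i l with rfl | ⟨l, rfl⟩
    · exact hzi _ hi
    · exact Ideal.mem_sup_right (Ideal.subset_span ⟨l, rfl⟩)

end LocalRing

section PolynomialRing

variable {K : Type*} [Field K] {m : ℕ}

lemma X_sub_C_mem_ker_eval {σ : Type*} (v : σ → K) (i : σ) :
    (X i - C (v i) : MvPolynomial σ K) ∈ RingHom.ker (eval v) := by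
  simp [RingHom.mem_ker]

/-- Substituting `v i` for the variables `X i` with `i ∈ s` does not change a polynomial modulo
the ideal generated by the `X i - v i`, `i ∈ s`. -/
lemma sub_aeval_ite_mem_span {σ : Type*} [DecidableEq σ] (v : σ → K) (s : Set σ)
    [DecidablePred (· ∈ s)] (g : MvPolynomial σ K) :
    g - aeval (fun i => if i ∈ s then C (v i) else X i : σ → MvPolynomial σ K) g ∈
      Ideal.span ((fun i => X i - C (v i) : σ → MvPolynomial σ K) '' s) := by
  set J := Ideal.span ((fun i => X i - C (v i) : σ → MvPolynomial σ K) '' s)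
  have key : (Ideal.Quotient.mkₐ K J) =
      (Ideal.Quotient.mkₐ K J).comp
        (aeval (fun i => if i ∈ s then C (v i) else X i : σ → MvPolynomial σ K)) := by
    ext i
    simp only [AlgHom.comp_apply, aeval_X, Ideal.Quotient.mkₐ_eq_mk]
    split_ifs with hi
    · exact Ideal.Quotient.eq.2 (Ideal.subset_span ⟨i, hi, rfl⟩)
    · rfl
  exact Ideal.Quotient.eq.1 (DFunLike.congr_fun key g)

lemma ker_eval_eq_span {σ : Type*} (v : σ → K) :
    RingHom.ker (eval v) =
      Ideal.span (Set.range (fun i => X i - C (v i) : σ → MvPolynomial σ K)) := by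
  classical
  refine le_antisymm (fun g hg => ?_) (Ideal.span_le.2 ?_)
  · have := sub_aeval_ite_mem_span v Set.univ g
    simp only [Set.mem_univ, if_true, Set.image_univ] at this
    have h2 : aeval (fun i => C (v i) : σ → MvPolynomial σ K) g = C (eval v g) := by
      clear hg this
      induction g using MvPolynomial.induction_on <;> simp_all
    rwa [h2, RingHom.mem_ker.1 hg, map_zero, sub_zero] at this
  · rintro _ ⟨i, rfl⟩
    exact X_sub_C_mem_ker_eval v i

lemma isRegularMod_X_sub_C {σ : Type*} (v : σ → K) (s : Set σ) {j : σ} (hj : j ∉ s) :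
    IsRegularMod (Ideal.span ((fun i => X i - C (v i) : σ → MvPolynomial σ K) '' s))
      (X j - C (v j)) := by
  classical
  intro g hg
  set φ := aeval (R := K) (fun i => if i ∈ s then C (v i) else X i : σ → MvPolynomial σ K)
  have hle : Ideal.span ((fun i => X i - C (v i) : σ → MvPolynomial σ K) '' s) ≤
      RingHom.ker φ := by
    refine Ideal.span_le.2 ?_
    rintro _ ⟨i, hi, rfl⟩
    simp [φ, RingHom.mem_ker, hi]
  have h1 : φ g * (X j - C (v j)) = 0 := by
    have := hle hg
    rw [RingHom.mem_ker, map_mul] at this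
    simpa [φ, hj] using this
  have hne : (X j - C (v j) : MvPolynomial σ K) ≠ 0 := by
    intro h
    have := congrArg (eval fun _ => v j + 1) h
    simp at this
  have h2 : φ g = 0 := (mul_eq_zero.1 h1).resolve_right hne
  have := sub_aeval_ite_mem_span v s g
  change g - φ g ∈ _ at this
  rwa [h2, sub_zero] at this

lemma hasRegularSeq_ker_eval (v : Fin m → K) : HasRegularSeq (RingHom.ker (eval v)) m ⊥ := by
  have key : ∀ t ≤ m, HasRegularSeq (RingHom.ker (eval v)) t
      (Ideal.span ((fun i => X i - C (v i) : Fin m → MvPolynomial (Fin m) K) ''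
        {i | i.val < m - t})) := by
    intro t
    induction t with
    | zero => exact fun _ => trivial
    | succ t ih =>
      intro ht
      set j : Fin m := ⟨m - (t + 1), by omega⟩ with hj
      refine ⟨X j - C (v j), X_sub_C_mem_ker_eval v j,
        isRegularMod_X_sub_C v _ (by simp [hj]), ?_⟩
      have h := ih (by omega)
      have hset : {i : Fin m | i.val < m - t} = {i : Fin m | i.val < m - (t + 1)} ∪ {j} := by
        ext i
        simp only [Set.mem_ofPred_eq, Set.mem_union, Set.mem_singleton_iff, Fin.ext_iff, hj]
        omega
      rwa [hset, Set.image_union, Set.image_singleton, Ideal.span_union] at h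
  simpa using key m le_rfl

/-- First order Taylor expansion. -/
lemma sub_sub_sum_pderiv_mem {σ : Type*} [Fintype σ] (v : σ → K) (g : MvPolynomial σ K) :
    g - C (eval v g) - ∑ i, C (eval v (pderiv i g)) * (X i - C (v i)) ∈
      RingHom.ker (eval v) * RingHom.ker (eval v) := by
  classical
  induction g using MvPolynomial.induction_on with
  | C a => simp
  | add p q hp hq =>
    have := Ideal.add_mem _ hp hq
    convert this using 1
    simp only [map_add, add_mul, Finset.sum_add_distrib]
    ring
  | mul_X p j hp =>
    have h1 : (p - C (eval v p)) * (X j - C (v j)) ∈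
        RingHom.ker (eval v) * RingHom.ker (eval v) :=
      Ideal.mul_mem_mul (by simp [RingHom.mem_ker]) (X_sub_C_mem_ker_eval v j)
    have := Ideal.add_mem _ h1 (Ideal.mul_mem_left _ (C (v j)) hp)
    convert this using 1
    have h2 : ∑ i, C (eval v (pderiv i (p * X j))) * (X i - C (v i)) =
        C (v j) * ∑ i, C (eval v (pderiv i p)) * (X i - C (v i)) +
          C (eval v p) * (X j - C (v j)) := by
      simp only [pderiv_mul, pderiv_X, map_add, map_mul, eval_X, add_mul, Finset.sum_add_distrib,
        Finset.mul_sum]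
      congr 1
      · exact Finset.sum_congr rfl fun i _ => by ring
      · rw [Finset.sum_eq_single j]
        · simp
        · intro i _ hij
          simp [hij.symm]
        · simp
    rw [h2]
    simp only [map_mul, eval_X]
    ring

lemma HasRegularSeq.of_regular_seq {R : Type*} [CommRing R] [IsNoetherianRing R] {n : Ideal R}
    {k t : ℕ} (h : HasRegularSeq n (k + t) ⊥) (f : Fin k → R) (hfn : ∀ j, f j ∈ n)
    (hreg : ∀ j, IsRegularMod (Ideal.span (f '' {i | i < j})) (f j)) :
    HasRegularSeq n t (Ideal.span (Set.range f)) := by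
  have key : ∀ j ≤ k, HasRegularSeq n (k - j + t) (Ideal.span (f '' {i | i.val < j})) := by
    intro j
    induction j with
    | zero => simpa using h
    | succ j ih =>
      intro hj
      have h1 := ih (by omega)
      rw [show k - j + t = k - (j + 1) + t + 1 by omega] at h1
      have h2 := h1.sup_span (hfn ⟨j, hj⟩) (hreg ⟨j, hj⟩)
      have hset : {i : Fin k | i.val < j + 1} = {i : Fin k | i.val < j} ∪ {⟨j, hj⟩} := by
        ext i
        simp only [Set.mem_ofPred_eq, Set.mem_union, Set.mem_singleton_iff, Fin.ext_iff]
        omega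
      rwa [hset, Set.image_union, Set.image_singleton, Ideal.span_union]
  simpa using key k le_rfl

/-- At a point where the Jacobian matrix of `f` has full rank, the maximal ideal is generated
modulo its square and modulo `f` by the expected number of elements. -/
lemma exists_ker_eval_le_sup {k t : ℕ} (hm : m = k + t) (f : Fin k → MvPolynomial (Fin m) K)
    (v : Fin m → K) (hv : ∀ j, eval v (f j) = 0)
    (hrank : (Matrix.of fun (j : Fin k) (i : Fin m) => eval v (pderiv i (f j))).rank = k) :
    ∃ z : Fin t → MvPolynomial (Fin m) K, (∀ l, z l ∈ RingHom.ker (eval v)) ∧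
      RingHom.ker (eval v) ≤ Ideal.span (Set.range f) ⊔ Ideal.span (Set.range z) ⊔
        RingHom.ker (eval v) * RingHom.ker (eval v) := by
  classical
  set A := Matrix.of fun (j : Fin k) (i : Fin m) => eval v (pderiv i (f j)) with hA
  set U : Submodule K (Fin m → K) := Submodule.span K (Set.range A.row) with hU
  have hUk : Module.finrank K U = k := by
    rw [← hrank, Matrix.rank_eq_finrank_span_row]
  obtain ⟨W, hW⟩ := Submodule.exists_isCompl U
  have hWt : Module.finrank K W = t := by
    have := Submodule.finrank_add_eq_of_isCompl hW
    simp at this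
    omega
  let b := Module.finBasisOfFinrankEq K W hWt
  let L : (Fin m → K) → MvPolynomial (Fin m) K := fun c => ∑ i, C (c i) * (X i - C (v i))
  have hLadd : ∀ c c', L (c + c') = L c + L c' := fun c c' => by
    simp [L, add_mul, Finset.sum_add_distrib]
  have hLsmul : ∀ (a : K) c, L (a • c) = C a * L c := fun a c => by
    simp [L, Finset.mul_sum, mul_assoc]
  have hLmem : ∀ c, L c ∈ RingHom.ker (eval v) := fun c =>
    Ideal.sum_mem _ fun i _ => Ideal.mul_mem_left _ _ (X_sub_C_mem_ker_eval v i)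
  refine ⟨fun l => L (b l), fun l => hLmem _, ?_⟩
  set T := Ideal.span (Set.range f) ⊔ Ideal.span (Set.range fun l => L (b l)) ⊔
    RingHom.ker (eval v) * RingHom.ker (eval v) with hT
  let T' : Submodule K (Fin m → K) :=
    { carrier := {c | L c ∈ T}
      add_mem' := fun {c c'} hc hc' => by
        change L (c + c') ∈ T
        rw [hLadd]
        exact T.add_mem hc hc'
      zero_mem' := by simp [L]
      smul_mem' := fun a c hc => by
        change L (a • c) ∈ T
        rw [hLsmul]
        exact T.mul_mem_left _ hc }
  have hUT : U ≤ T' := by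
    refine Submodule.span_le.2 ?_
    rintro _ ⟨j, rfl⟩
    change L (A.row j) ∈ T
    have h1 := sub_sub_sum_pderiv_mem v (f j)
    rw [hv j, map_zero, sub_zero] at h1
    have h2 : f j ∈ T := Ideal.mem_sup_left (Ideal.mem_sup_left (Ideal.subset_span ⟨j, rfl⟩))
    have h3 := T.sub_mem h2 (Ideal.mem_sup_right h1 : _ ∈ T)
    rwa [sub_sub_cancel] at h3
  have hWT : W ≤ T' := by
    intro c hc
    have h1 := b.sum_repr ⟨c, hc⟩
    have h2 : c = ∑ l, b.repr ⟨c, hc⟩ l • (b l : Fin m → K) := by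
      have h3 := congrArg W.subtype h1
      rw [map_sum] at h3
      exact h3.symm
    rw [h2]
    refine T'.sum_mem fun l _ => T'.smul_mem _ ?_
    exact Ideal.mem_sup_left (Ideal.mem_sup_right (Ideal.subset_span ⟨l, rfl⟩))
  have htop : T' = ⊤ := top_le_iff.1 (hW.sup_eq_top ▸ sup_le hUT hWT)
  conv_lhs => rw [ker_eval_eq_span]
  refine Ideal.span_le.2 ?_
  rintro _ ⟨i, rfl⟩
  have : Pi.single i (1 : K) ∈ T' := htop ▸ Submodule.mem_top
  change L (Pi.single i 1) ∈ T at this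
  have hLs : L (Pi.single i 1) = X i - C (v i) := by
    simp only [L]
    rw [Finset.sum_eq_single i] <;> simp +contextual
  rwa [hLs] at this

/-- Through a point at which the Jacobian matrix of the regular sequence `f` has full rank there
passes only one irreducible component of the zero locus of `f`. -/
lemma eq_of_mem_minimalPrimes_of_le_ker_eval {k t : ℕ} (hm : m = k + t)
    (f : Fin k → MvPolynomial (Fin m) K)
    (hreg : ∀ j, IsRegularMod (Ideal.span (f '' {i | i < j})) (f j))
    (v : Fin m → K) (hv : ∀ j, eval v (f j) = 0)
    (hrank : (Matrix.of fun (j : Fin k) (i : Fin m) => eval v (pderiv i (f j))).rank = k)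
    {P Q : Ideal (MvPolynomial (Fin m) K)} (hP : P ∈ (Ideal.span (Set.range f)).minimalPrimes)
    (hQ : Q ∈ (Ideal.span (Set.range f)).minimalPrimes)
    (hPv : P ≤ RingHom.ker (eval v)) (hQv : Q ≤ RingHom.ker (eval v)) : P = Q := by
  set J := Ideal.span (Set.range f) with hJ
  set n := RingHom.ker (eval v) with hn
  have hprime : n.IsPrime := RingHom.ker_isPrime _
  have hJn : J ≤ n := hP.1.2.trans hPv
  have hD : HasRegularSeq n t J :=
    HasRegularSeq.of_regular_seq (hm ▸ hasRegularSeq_ker_eval v) f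
      (fun j => (hv j : eval v (f j) = 0)) hreg
  obtain ⟨z, hz, hnz⟩ := exists_ker_eval_le_sup hm f v hv hrank
  set S := Localization.AtPrime n
  have hmax : n.map (algebraMap (MvPolynomial (Fin m) K) S) = IsLocalRing.maximalIdeal S :=
    Localization.AtPrime.map_eq_maximalIdeal
  have hD' := hD.map_localization n.primeCompl S
  rw [hmax] at hD'
  have hpr : (J.map (algebraMap (MvPolynomial (Fin m) K) S)).IsPrime := by
    refine hD'.isPrime (hmax ▸ Ideal.map_mono hJn) (fun l => algebraMap (MvPolynomial (Fin m) K) S (z l))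
      (fun l => hmax ▸ Ideal.mem_map_of_mem _ (hz l)) ?_
    refine Submodule.le_of_le_smul_of_le_jacobson_bot (I := IsLocalRing.maximalIdeal S)
      (IsNoetherian.noetherian _) (IsLocalRing.maximalIdeal_le_jacobson _) ?_
    have := Ideal.map_mono (f := algebraMap (MvPolynomial (Fin m) K) S) hnz
    rw [Ideal.map_sup, Ideal.map_sup, Ideal.map_mul, hmax, Ideal.map_span _ (Set.range z),
      ← Set.range_comp] at this
    exact this
  set J' := (J.map (algebraMap (MvPolynomial (Fin m) K) S)).comap
    (algebraMap (MvPolynomial (Fin m) K) S)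
  have hpr' : J'.IsPrime := Ideal.IsPrime.comap _
  have key : ∀ P ∈ J.minimalPrimes, P ≤ n → P = J' := by
    intro P hP hPn
    have hPp : P.IsPrime := hP.1.1
    have hle : J' ≤ P := by
      intro a ha
      obtain ⟨s, hs, hsa⟩ :=
        (IsLocalization.algebraMap_mem_map_algebraMap_iff n.primeCompl S J a).1 ha
      exact (hPp.mem_or_mem (hP.1.2 hsa)).resolve_left fun hsP => hs (hPn hsP)
    exact le_antisymm (hP.2 ⟨hpr', Ideal.le_comap_map⟩ hle) hle
  rw [key P hP hPv, key Q hQ hQv]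

/-- Hartshorne's connectedness argument: if `J` has depth at least two at the origin, all its
minimal primes pass through the origin, and no two of them meet anywhere else, then there is only
one of them. -/
lemma isPrime_radical_of_hasRegularSeq_two [IsAlgClosed K] {J : Ideal (MvPolynomial (Fin m) K)}
    (hJ : J ≤ RingHom.ker (eval (0 : Fin m → K)))
    (hD : HasRegularSeq (RingHom.ker (eval (0 : Fin m → K))) 2 J)
    (hmin : ∀ P ∈ J.minimalPrimes, P ≤ RingHom.ker (eval (0 : Fin m → K)))
    (hloc : ∀ v : Fin m → K, v ≠ 0 → ∀ P ∈ J.minimalPrimes, ∀ Q ∈ J.minimalPrimes,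
      P ≤ RingHom.ker (eval v) → Q ≤ RingHom.ker (eval v) → P = Q) :
    J.radical.IsPrime := by
  classical
  set n := RingHom.ker (eval (0 : Fin m → K)) with hn
  have hnp : n.IsPrime := RingHom.ker_isPrime _
  obtain ⟨a, han, ha, b, hbn, hb, -⟩ := hD
  obtain ⟨P, hP, -⟩ := Ideal.exists_minimalPrimes_le hJ
  suffices hall : ∀ Q ∈ J.minimalPrimes, Q = P by
    have hset : J.minimalPrimes = {P} := Set.eq_singleton_iff_unique_mem.2 ⟨hP, hall⟩
    rw [← Ideal.sInf_minimalPrimes, hset, sInf_singleton]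
    exact hP.1.1
  by_contra! hcon
  obtain ⟨Q, hQ, hQP⟩ := hcon
  have hfin : (J.minimalPrimes \ {P}).Finite :=
    J.finite_minimalPrimes_of_isNoetherianRing.subset Set.sdiff_subset
  set I := sInf (J.minimalPrimes \ {P}) with hI
  have hIQ : I ≤ Q := sInf_le ⟨hQ, hQP⟩
  have hPI : P * I ≤ J.radical := by
    rw [← Ideal.sInf_minimalPrimes]
    refine le_sInf fun P' hP' => ?_
    by_cases h : P' = P
    · exact Ideal.mul_le_left.trans h.ge
    · exact Ideal.mul_le_right.trans (sInf_le (show P' ∈ J.minimalPrimes \ {P} from ⟨hP', h⟩))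
  obtain ⟨e, he⟩ := J.exists_radical_pow_le_of_fg (IsNoetherian.noetherian _)
  have hPIe : P ^ e * I ^ e ≤ J := by
    rw [← mul_pow]
    exact (Ideal.pow_right_mono hPI e).trans he
  have hrad : n ≤ (P ^ e ⊔ I ^ e).radical := by
    rw [← vanishingIdeal_zeroLocus_eq_radical (K := K)]
    intro g hg v hv
    have hle : P ^ e ⊔ I ^ e ≤ RingHom.ker (eval v) := fun p hp => by
      simpa [RingHom.mem_ker] using hv p hp
    have hvp : (RingHom.ker (eval v)).IsPrime := RingHom.ker_isPrime _
    have hPv : P ≤ RingHom.ker (eval v) := hvp.le_of_pow_le (le_sup_left.trans hle)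
    have hIv : I ≤ RingHom.ker (eval v) := hvp.le_of_pow_le (le_sup_right.trans hle)
    obtain ⟨P', hP', hP'v⟩ : ∃ P' ∈ J.minimalPrimes \ {P}, P' ≤ RingHom.ker (eval v) := by
      have h2 : hfin.toFinset.inf id ≤ RingHom.ker (eval v) := by
        rwa [Finset.inf_id_eq_sInf, hfin.coe_toFinset]
      obtain ⟨P', hP', h3⟩ := (Ideal.IsPrime.inf_le' hvp).1 h2
      exact ⟨P', hfin.mem_toFinset.1 hP', h3⟩
    have hv0 : v = 0 := by
      by_contra hv0
      exact hP'.2 (hloc v hv0 P' hP'.1 P hP hP'v hPv)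
    rw [hv0]
    simpa [hn, RingHom.mem_ker] using hg
  obtain ⟨p, hp⟩ := hrad han
  obtain ⟨q, hq⟩ := hrad hbn
  obtain ⟨α, hα, β, hβ, hab⟩ := Submodule.mem_sup.1 hp
  obtain ⟨α', hα', β', hβ', hab'⟩ := Submodule.mem_sup.1 hq
  have h1 : ∀ {x y}, x ∈ P ^ e → y ∈ I ^ e → x * y ∈ J := fun hx hy =>
    hPIe (Ideal.mul_mem_mul hx hy)
  have hαmem : α ∈ J ⊔ Ideal.span {a ^ p} := by
    refine (ha.sup_span_pow hb p).pow q _ (mem_sup_span_singleton_iff.2 ⟨α', ?_⟩)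
    have := J.sub_mem (h1 hα hβ') (h1 hα' hβ)
    convert this using 1
    rw [← hab, ← hab']
    ring
  obtain ⟨c, hc⟩ := mem_sup_span_singleton_iff.1 hαmem
  have hcJ : c * (1 - c) ∈ J := by
    refine (ha.pow (p + p)) _ ?_
    have h2 := h1 hα hβ
    have h3 : β = a ^ p - α := by rw [← hab]; ring
    have h4 := J.sub_mem h2 (J.mul_mem_left (a ^ p - α - c * a ^ p) hc)
    convert h4 using 1
    rw [h3]
    ring
  have haP : ∀ P' ∈ J.minimalPrimes, a ∉ P' := fun P' hP' => ha.notMem_of_mem_minimalPrimes hP'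
  have he0 : e ≠ 0 := by
    rintro rfl
    rw [pow_zero, pow_zero, one_mul, Ideal.one_eq_top] at hPIe
    exact hnp.ne_top (top_le_iff.1 (hPIe.trans hJ))
  have hPp : P.IsPrime := hP.1.1
  have hQp : Q.IsPrime := hQ.1.1
  by_cases hcn : c ∈ n
  · have hcn' : 1 - c ∉ n := fun h => hnp.ne_top ((Ideal.eq_top_iff_one _).2 (by
      simpa using n.add_mem h hcn))
    have hcQ : c ∈ Q := (hQp.mem_or_mem (hQ.1.2 hcJ)).resolve_right fun h => hcn' (hmin Q hQ h)
    have hαQ : α ∈ Q := by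
      simpa using Q.add_mem (hQ.1.2 hc) (Q.mul_mem_right (a ^ p) hcQ)
    have hβQ : β ∈ Q := hIQ (Ideal.pow_le_self he0 hβ)
    exact haP Q hQ (hQp.mem_of_pow_mem p (hab ▸ Q.add_mem hαQ hβQ))
  · have hcP : 1 - c ∈ P := (hPp.mem_or_mem (hP.1.2 hcJ)).resolve_left fun h => hcn (hmin P hP h)
    have hβP : a ^ p - α ∈ P := by
      have := P.sub_mem (P.mul_mem_right (a ^ p) hcP) (hP.1.2 hc)
      convert this using 1
      ring
    have hαP : α ∈ P := Ideal.pow_le_self he0 hα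
    exact haP P hP (hPp.mem_of_pow_mem p (by simpa using P.add_mem hβP hαP))

end PolynomialRing

section WeightedProjectiveSpace

attribute [local instance] weightedGradedAlgebra

/-- The minimal primes of a homogeneous ideal in a polynomial ring with positive weights are
contained in the ideal of the origin. -/
lemma le_ker_eval_zero_of_mem_minimalPrimes {K σ : Type*} [Field K] {w : σ → ℕ}
    (hw : ∀ i, w i ≠ 0) {J P : Ideal (MvPolynomial σ K)}
    (hJ : J.IsHomogeneous (weightedHomogeneousSubmodule K w)) (hP : P ∈ J.minimalPrimes) :
    P ≤ RingHom.ker (eval (0 : σ → K)) := by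
  have hPp : P.IsPrime := hP.1.1
  have hcore := Ideal.toIdeal_homogeneousCore_le (weightedHomogeneousSubmodule K w) P
  have hJcore : J ≤ (P.homogeneousCore (weightedHomogeneousSubmodule K w)).toIdeal := by
    rw [← hJ.toIdeal_homogeneousCore_eq_self]
    exact Ideal.homogeneousCore_mono _ hP.1.2
  have hPhom : P.IsHomogeneous (weightedHomogeneousSubmodule K w) := by
    have : P = (P.homogeneousCore (weightedHomogeneousSubmodule K w)).toIdeal :=
      le_antisymm (hP.2 ⟨hPp.homogeneousCore, hJcore⟩ hcore) hcore
    rw [this]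
    exact (P.homogeneousCore (weightedHomogeneousSubmodule K w)).isHomogeneous
  intro g hg
  have h0 := weightedHomogeneousComponent_mem_of_mem K w hPhom hg 0
  rw [weightedHomogeneousComponent_zero g hw] at h0
  rw [RingHom.mem_ker, ← coe_aeval_eq_eval, RingHom.coe_coe, aeval_zero]
  by_contra hne
  refine hPp.ne_top (Ideal.eq_top_of_isUnit_mem _ h0 ?_)
  exact (isUnit_iff_ne_zero.2 (by simpa [constantCoeff_eq] using hne)).map C

lemma isIrreducible_zeroLocus_of_isPrime_radical {A τ : Type*} [CommRing A] [SetLike τ A]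
    [AddSubmonoidClass τ A] (𝒜 : ℕ → τ) [GradedRing 𝒜] {s : Set A}
    (hs : (Ideal.span s).IsHomogeneous 𝒜) (hp : (Ideal.span s).radical.IsPrime)
    (hirr : ¬ HomogeneousIdeal.irrelevant 𝒜 ≤ ⟨(Ideal.span s).radical, hs.radical⟩) :
    IsIrreducible (ProjectiveSpectrum.zeroLocus 𝒜 s) := by
  let x : ProjectiveSpectrum 𝒜 := ⟨⟨(Ideal.span s).radical, hs.radical⟩, hp, hirr⟩
  have hx : ProjectiveSpectrum.zeroLocus 𝒜 s = closure {x} := by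
    ext y
    rw [← ProjectiveSpectrum.le_iff_mem_closure, ProjectiveSpectrum.mem_zeroLocus,
      ← ProjectiveSpectrum.as_ideal_le_as_ideal]
    have hy : (y.asHomogeneousIdeal.toIdeal).IsPrime := y.isPrime
    change s ⊆ y.asHomogeneousIdeal.toIdeal ↔
      (Ideal.span s).radical ≤ y.asHomogeneousIdeal.toIdeal
    rw [hy.radical_le_iff, Ideal.span_le]
  rw [hx]
  exact isIrreducible_singleton.closure

end WeightedProjectiveSpace

/-- The zero locus, in the projective spectrum of `ℂ[x_0, …, x_N]` graded by
weighted degree (i.e. in the weighted projective space `ℙ(w(0), …, w(N))`), of a regular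
sequence `f_1, …, f_k` (with `1 ≤ k ≤ N - 1`) of weighted homogeneous polynomials of positive
weighted degrees defining a quasi-smooth complete intersection is irreducible. -/
theorem quasi_smooth_weighted_complete_intersection_irreducible
    (N : ℕ) (hN : 1 ≤ N) (w : Fin (N + 1) → ℕ) (hw : ∀ i, 0 < w i)
    (k : ℕ) (hk : 1 ≤ k) (hkN : k ≤ N - 1)
    (f : Fin k → MvPolynomial (Fin (N + 1)) ℂ) (d : Fin k → ℕ)
    (hd : ∀ j, 0 < d j)
    (hf : ∀ j, IsWeightedHomogeneous w (f j) (d j))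
    -- `f` is a regular sequence: each `f j` is a nonzerodivisor modulo the ideal generated by
    -- the previous ones, and the `f j` generate a proper ideal.
    (hreg : ∀ j : Fin k, ∀ g : MvPolynomial (Fin (N + 1)) ℂ,
      g * f j ∈ Ideal.span (f '' {i | i < j}) → g ∈ Ideal.span (f '' {i | i < j}))
    (hproper : Ideal.span (Set.range f) ≠ ⊤)
    -- quasi-smoothness: at every nonzero point of the affine cone, the Jacobian matrix
    -- has rank `k`.
    (hqs : ∀ v : Fin (N + 1) → ℂ, v ≠ 0 → (∀ j, eval v (f j) = 0) →
      (Matrix.of fun (j : Fin k) (i : Fin (N + 1)) => eval v (pderiv i (f j))).rank = k) :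
    letI := weightedGradedAlgebra ℂ w
    IsIrreducible (ProjectiveSpectrum.zeroLocus
      (weightedHomogeneousSubmodule ℂ w) (Set.range f)) := by
  let _ := weightedGradedAlgebra ℂ w
  obtain ⟨t, ht⟩ : ∃ t, N + 1 = k + (t + 2) := ⟨N + 1 - k - 2, by omega⟩
  have hf0 : ∀ j, eval 0 (f j) = 0 := fun j => by
    have h := (hf j).coeff_eq_zero 0 (by simpa using (hd j).ne)
    rw [← coe_aeval_eq_eval, RingHom.coe_coe, aeval_zero]
    simpa [constantCoeff_eq] using h
  have hhom : (Ideal.span (Set.range f)).IsHomogeneous (weightedHomogeneousSubmodule ℂ w) := by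
    refine Ideal.homogeneous_span _ _ ?_
    rintro _ ⟨j, rfl⟩
    exact ⟨d j, hf j⟩
  have hle : Ideal.span (Set.range f) ≤ RingHom.ker (eval (0 : Fin (N + 1) → ℂ)) := by
    refine Ideal.span_le.2 ?_
    rintro _ ⟨j, rfl⟩
    exact hf0 j
  have hD : HasRegularSeq (RingHom.ker (eval (0 : Fin (N + 1) → ℂ))) 2
      (Ideal.span (Set.range f)) :=
    (HasRegularSeq.of_regular_seq (ht ▸ hasRegularSeq_ker_eval 0) f hf0 hreg).mono
      (Nat.le_add_left 2 t)
  have hprime : (Ideal.span (Set.range f)).radical.IsPrime := by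
    refine isPrime_radical_of_hasRegularSeq_two hle hD
      (fun P hP => le_ker_eval_zero_of_mem_minimalPrimes (fun i => (hw i).ne') hhom hP) ?_
    intro v hv P hP Q hQ hPv hQv
    have hfv : ∀ j, eval v (f j) = 0 := fun j =>
      hPv (hP.1.2 (Ideal.subset_span ⟨j, rfl⟩))
    exact eq_of_mem_minimalPrimes_of_le_ker_eval ht f hreg v hfv (hqs v hv hfv) hP hQ hPv hQv
  refine isIrreducible_zeroLocus_of_isPrime_radical _ hhom hprime fun hirr => ?_
  obtain ⟨a, han, ha, -⟩ := hD
  have hker : RingHom.ker (eval (0 : Fin (N + 1) → ℂ)) ≤ (Ideal.span (Set.range f)).radical := by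
    rw [ker_eval_eq_span]
    refine Ideal.span_le.2 ?_
    rintro _ ⟨i, rfl⟩
    have hX := HomogeneousIdeal.mem_irrelevant_of_mem (weightedHomogeneousSubmodule ℂ w) (hw i)
      (isWeightedHomogeneous_X ℂ w i)
    have hXrad : X i ∈ (Ideal.span (Set.range f)).radical := hirr hX
    simpa using hXrad
  obtain ⟨p, hp⟩ := hker han
  exact hproper ((Ideal.eq_top_iff_one _).2 (ha.pow p 1 (by rwa [one_mul])))
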